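/- arXiv:2505.07137 — 4 statements merged into one kernel-verified Lean document; each statement's English description precedes it below -/
import Mathlib

section
/- Let d ≥ 2 and let Δ ⊂ ℝ^{d+1} be a nondegenerate (d+1)-simplex. Then there exist an integer m with 1 ≤ m ≤ d² and affine functions g_1, …, g_m : ℝ^d → ℝ such that for every x ∈ ℝ^d one has τ(Δ)(x) = max(0, min_{1≤i≤m} g_i(x)). -/
open MeasureTheory

noncomputable section

/-- Orthogonal projection ℝ^{d+1} → ℝ^d forgetting the last coordinate. -/
def proj (d : ℕ) (y : Fin (d + 1) → ℝ) : Fin d → ℝ := fun i => y i.castSucc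

/-- `v` lists the `d+2` vertices of a nondegenerate `(d+1)`-simplex in `ℝ^{d+1}`:
the vertices are affinely independent (so the simplex is full dimensional), and for each
vertex `i` the projection of the opposite `d`-dimensional face is a full dimensional
`d`-simplex in `ℝ^d` (its projected vertices are affinely independent). -/
def IsNondegSimplex (d : ℕ) (v : Fin (d + 2) → (Fin (d + 1) → ℝ)) : Prop :=
  AffineIndependent ℝ v ∧
    ∀ i : Fin (d + 2),
      AffineIndependent ℝ (fun j : {j : Fin (d + 2) // j ≠ i} => proj d (v j.1))

/-- The simplex function `τ(Δ)`: the length (1-dimensional Lebesgue measure) of the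
intersection of the vertical line over `x` with the simplex with vertices `v`. -/
def simplexFn (d : ℕ) (v : Fin (d + 2) → (Fin (d + 1) → ℝ)) (x : Fin d → ℝ) : ℝ :=
  (volume {t : ℝ | Fin.snoc x t ∈ convexHull ℝ (Set.range v)}).toReal

/-- Linear embedding `x ↦ (x, 0)`. -/
def emb0 (d : ℕ) : (Fin d → ℝ) →ₗ[ℝ] (Fin (d + 1) → ℝ) where
  toFun x := Fin.snoc x 0
  map_add' x y := by
    funext i
    refine Fin.lastCases ?_ (fun j => ?_) i <;> simp
  map_smul' c x := by
    funext i
    refine Fin.lastCases ?_ (fun j => ?_) i <;> simp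

/-- The vertical direction. -/
def vert (d : ℕ) : Fin (d + 1) → ℝ := Pi.single (Fin.last d) 1

lemma snoc_eq (d : ℕ) (x : Fin d → ℝ) (t : ℝ) :
    (Fin.snoc x t : Fin (d + 1) → ℝ) = t • vert d +ᵥ emb0 d x := by
  funext i
  refine Fin.lastCases ?_ (fun j => ?_) i <;> simp [emb0, vert]

lemma affine_snoc (d : ℕ) (f : (Fin (d + 1) → ℝ) →ᵃ[ℝ] ℝ) (x : Fin d → ℝ) (t : ℝ) :
    f (Fin.snoc x t : Fin (d + 1) → ℝ) = f (emb0 d x) + t * f.linear (vert d) := by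
  rw [snoc_eq, f.map_vadd, map_smul]
  simp [add_comm]

lemma affine_self (d : ℕ) (f : (Fin (d + 1) → ℝ) →ᵃ[ℝ] ℝ) (y : Fin (d + 1) → ℝ) :
    f y = f (emb0 d (proj d y)) + y (Fin.last d) * f.linear (vert d) := by
  rw [← affine_snoc]
  congr 1
  funext i
  refine Fin.lastCases ?_ (fun j => ?_) i <;> simp [proj]

lemma coord_vert_ne (d : ℕ) (v : Fin (d + 2) → (Fin (d + 1) → ℝ)) (hv : IsNondegSimplex d v)
    (b : AffineBasis (Fin (d + 2)) ℝ (Fin (d + 1) → ℝ)) (hb : ⇑b = v) (i : Fin (d + 2)) :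
    (b.coord i).linear (vert d) ≠ 0 := by
  intro h0
  have hself : ∀ y, b.coord i y = b.coord i (emb0 d (proj d y)) := by
    intro y
    rw [affine_self d (b.coord i) y, h0]; simp
  have hspan : affineSpan ℝ (Set.range
      (fun j : {j : Fin (d + 2) // j ≠ i} => proj d (v j.1))) = ⊤ := by
    rw [(hv.2 i).affineSpan_eq_top_iff_card_eq_finrank_add_one]
    simp
  have heq : Set.EqOn ((b.coord i).comp (emb0 d).toAffineMap)
      (AffineMap.const ℝ (Fin d → ℝ) (0 : ℝ)) (Set.range
      (fun j : {j : Fin (d + 2) // j ≠ i} => proj d (v j.1))) := by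
    rintro _ ⟨j, rfl⟩
    have := hself (v j.1)
    rw [← hb, b.coord_apply_ne (Ne.symm j.2)] at this
    simp [← hb, ← this]
  have := AffineMap.ext_on hspan heq
  have h1 := congrArg (fun f => f (proj d (v i))) this
  have h2 := hself (v i)
  rw [← hb, b.coord_apply_eq] at h2
  simp [← hb, ← h2] at h1

/-- Max–min normal form for simplex functions: `τ(Δ) = max(0, min_i g_i)` for at most `d²`
affine functions `g_i`. -/
theorem simplexFn_eq_max_min (d : ℕ) (hd : 2 ≤ d)
    (v : Fin (d + 2) → (Fin (d + 1) → ℝ)) (hv : IsNondegSimplex d v) :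
    ∃ (m : ℕ) (hm : 1 ≤ m) (_ : m ≤ d ^ 2)
      (g : Fin m → ((Fin d → ℝ) →ᵃ[ℝ] ℝ)),
      ∀ x : Fin d → ℝ,
        simplexFn d v x =
          max 0 (Finset.univ.inf'
            (Finset.univ_nonempty_iff.mpr (Fin.pos_iff_nonempty.mp hm))
            (fun i => g i x)) := by
  classical
  obtain ⟨b, hb⟩ : ∃ b : AffineBasis (Fin (d + 2)) ℝ (Fin (d + 1) → ℝ), ⇑b = v :=
    ⟨⟨v, hv.1, by
      rw [hv.1.affineSpan_eq_top_iff_card_eq_finrank_add_one]; simp⟩, rfl⟩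
  set c : Fin (d + 2) → ℝ := fun i => (b.coord i).linear (vert d) with hc
  have hc0 : ∀ i, c i ≠ 0 := coord_vert_ne d v hv b hb
  have hsum : ∑ i, c i = 0 := by
    have h1 := b.sum_coord_apply_eq_one (Fin.snoc (0 : Fin d → ℝ) (1 : ℝ) : Fin (d + 1) → ℝ)
    have h2 := b.sum_coord_apply_eq_one (emb0 d 0)
    simp only [affine_snoc, Finset.sum_add_distrib, h2] at h1
    simpa [hc] using h1
  let P := {i : Fin (d + 2) // 0 < c i}
  let N := {i : Fin (d + 2) // ¬ 0 < c i}
  have hN : ∀ j : N, c j.1 < 0 := fun j => lt_of_le_of_ne (not_lt.1 j.2) (hc0 _)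
  have hPne : Nonempty P := by
    by_contra h
    have h' : ∀ i, c i < 0 := fun i =>
      lt_of_le_of_ne (not_lt.1 fun hi => h ⟨⟨i, hi⟩⟩) (hc0 i)
    have := Finset.sum_neg (fun i (_ : i ∈ Finset.univ) => h' i) Finset.univ_nonempty
    linarith
  have hNne : Nonempty N := by
    by_contra h
    have h' : ∀ i, 0 < c i := fun i => by
      by_contra hi
      exact h ⟨⟨i, hi⟩⟩
    have := Finset.sum_pos (fun i (_ : i ∈ Finset.univ) => h' i) Finset.univ_nonempty
    linarith
  have hcard : Fintype.card P + Fintype.card N = d + 2 := by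
    have := Fintype.card_subtype_compl (fun i : Fin (d + 2) => 0 < c i)
    have h2 := Fintype.card_subtype_le (fun i : Fin (d + 2) => 0 < c i)
    simp only [Fintype.card_fin] at this h2
    change Fintype.card {i : Fin (d + 2) // 0 < c i} +
      Fintype.card {i : Fin (d + 2) // ¬ 0 < c i} = d + 2
    omega
  let a : Fin (d + 2) → ((Fin d → ℝ) →ᵃ[ℝ] ℝ) := fun i =>
    (-(c i)⁻¹) • ((b.coord i).comp (emb0 d).toAffineMap)
  have hmem : ∀ x t, (Fin.snoc x t : Fin (d + 1) → ℝ) ∈ convexHull ℝ (Set.range v) ↔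
      (∀ i : P, a i.1 x ≤ t) ∧ (∀ j : N, t ≤ a j.1 x) := by
    intro x t
    have key : ∀ i, b.coord i (Fin.snoc x t : Fin (d + 1) → ℝ) = c i * (t - a i x) := by
      intro i
      rw [affine_snoc]
      have := hc0 i
      simp only [a, AffineMap.coe_smul, Pi.smul_apply, AffineMap.comp_apply, LinearMap.coe_toAffineMap,
        smul_eq_mul]
      change _ + t * c i = _
      field_simp
      ring
    rw [← hb, b.convexHull_eq_nonneg_coord]
    simp only [Set.mem_ofPred_eq, key]
    constructor
    · intro h
      refine ⟨fun i => ?_, fun j => ?_⟩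
      · have := nonneg_of_mul_nonneg_right (h i.1) i.2
        linarith
      · have := h j.1
        have := hN j
        by_contra hlt
        push Not at hlt
        nlinarith
    · rintro ⟨h1, h2⟩ i
      by_cases hi : 0 < c i
      · exact mul_nonneg hi.le (sub_nonneg.2 (h1 ⟨i, hi⟩))
      · exact mul_nonneg_of_nonpos_of_nonpos (not_lt.1 hi) (sub_nonpos.2 (h2 ⟨i, hi⟩))
  let e := Fintype.equivFin (P × N)
  refine ⟨Fintype.card (P × N), Fintype.card_pos, ?_,
    fun k => a (e.symm k).2.1 - a (e.symm k).1.1, fun x => ?_⟩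
  · rw [Fintype.card_prod]
    generalize Fintype.card P = p at *
    generalize Fintype.card N = q at *
    zify at *
    nlinarith [sq_nonneg ((p : ℤ) - q)]
  · set L := Finset.univ.sup' Finset.univ_nonempty (fun i : P => a i.1 x) with hL
    set U := Finset.univ.inf' Finset.univ_nonempty (fun j : N => a j.1 x) with hU
    have hset : {t : ℝ | (Fin.snoc x t : Fin (d + 1) → ℝ) ∈ convexHull ℝ (Set.range v)}
        = Set.Icc L U := by
      ext t
      simp only [Set.mem_ofPred_eq, hmem, Set.mem_Icc, hL, hU, Finset.sup'_le_iff,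
        Finset.le_inf'_iff, Finset.mem_univ, true_imp_iff]
    unfold simplexFn
    rw [hset, Real.volume_Icc, ENNReal.toReal_ofReal', max_comm]
    congr 1
    apply le_antisymm
    · apply Finset.le_inf'
      intro k _
      have h1 : a (e.symm k).1.1 x ≤ L :=
        Finset.le_sup' (fun i : P => a i.1 x) (Finset.mem_univ (e.symm k).1)
      have h2 : U ≤ a (e.symm k).2.1 x :=
        Finset.inf'_le (fun j : N => a j.1 x) (Finset.mem_univ (e.symm k).2)
      simp only [AffineMap.coe_sub, Pi.sub_apply]
      linarith
    · obtain ⟨i, -, hi⟩ := Finset.exists_mem_eq_sup' Finset.univ_nonempty (fun i : P => a i.1 x)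
      obtain ⟨j, -, hj⟩ := Finset.exists_mem_eq_inf' Finset.univ_nonempty (fun j : N => a j.1 x)
      refine (Finset.inf'_le _ (Finset.mem_univ (e (i, j)))).trans ?_
      simp only [AffineMap.coe_sub, Pi.sub_apply, Equiv.symm_apply_apply]
      rw [hL, hU, hi, hj]
end
end

section
/- Let d ≥ 2 and let Δ ⊂ ℝ^{d+1} be a nondegenerate (d+1)-simplex. Then there exist at most d² d-simplices σ_1, …, σ_m in ℝ^d with pairwise disjoint interiors such that the simplex function τ(Δ) is affine on each σ_i and vanishes outside the union of the σ_i; that is, τ(Δ) belongs to the class PL(d, d²). -/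
open MeasureTheory

noncomputable section

/-- Membership in the convex hull of a finite family. -/
theorem mem_hull_range {ι E : Type*} [Fintype ι] [AddCommGroup E] [Module ℝ E] (w : ι → E) (x : E) :
    x ∈ convexHull ℝ (Set.range w) ↔
      ∃ a : ι → ℝ, (∀ i, 0 ≤ a i) ∧ ∑ i, a i = 1 ∧ ∑ i, a i • w i = x := by
  classical
  have h : Set.range w = (Fintype.linearCombination ℝ w) '' Set.range (fun i : ι => Pi.single i (1:ℝ)) := by
    ext y
    simp [Fintype.linearCombination_apply_single]
  rw [h, ← LinearMap.image_convexHull, convexHull_rangle_single_eq_stdSimplex]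
  constructor
  · rintro ⟨a, ⟨h0, h1⟩, rfl⟩
    exact ⟨a, h0, h1, by simp [Fintype.linearCombination_apply]⟩
  · rintro ⟨a, h0, h1, rfl⟩
    exact ⟨a, ⟨h0, h1⟩, by simp [Fintype.linearCombination_apply]⟩

/-- Positive part of a dependency. -/
def lpos {d : ℕ} (l : Fin (d + 2) → ℝ) (k : Fin (d + 2)) : ℝ := max (l k) 0

/-- The Radon point. -/
def radonPt {d : ℕ} (p : Fin (d + 2) → Fin d → ℝ) (l : Fin (d + 2) → ℝ) : Fin d → ℝ :=
  ∑ k, lpos l k • p k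

/-- Vertices of the small simplices. -/
def smallV {d : ℕ} (p : Fin (d + 2) → Fin d → ℝ) (l : Fin (d + 2) → ℝ) (i j : Fin (d + 2))
    (k : Fin (d + 1)) : Fin d → ℝ :=
  if j.succAbove k = i then radonPt p l else p (j.succAbove k)

/-- Coefficients with respect to `p` from coefficients with respect to `smallV`. -/
def liftA {d : ℕ} (l : Fin (d + 2) → ℝ) (i : Fin (d + 2)) (m : Fin (d + 2) → ℝ)
    (k : Fin (d + 2)) : ℝ :=
  m i * lpos l k + if k = i then 0 else m k

theorem sum_liftA {d : ℕ} (l : Fin (d + 2) → ℝ) (i j : Fin (d + 2))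
    (m : Fin (d + 2) → ℝ) (hj : m j = 0) (hl : ∑ k, lpos l k = 1) :
    ∑ k, liftA l i m k = ∑ k, m (j.succAbove k) := by
  have h1 : ∑ k, m k = ∑ k, m (j.succAbove k) := by
    rw [Fin.sum_univ_succAbove _ j, hj, zero_add]
  have h2 : ∑ k, (if k = i then 0 else m k) = ∑ k, m k - m i := by
    rw [eq_sub_iff_add_eq]
    have : m i = ∑ k, (if k = i then m k else 0) := by simp
    rw [this, ← Finset.sum_add_distrib]
    exact Finset.sum_congr rfl fun k _ => by split_ifs <;> simp
  simp only [liftA, Finset.sum_add_distrib, ← Finset.mul_sum, hl, h2, ← h1]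
  ring

theorem sum_liftA_smul {d : ℕ} (p : Fin (d + 2) → Fin d → ℝ) (l : Fin (d + 2) → ℝ)
    (i j : Fin (d + 2)) (m : Fin (d + 2) → ℝ) (hj : m j = 0) :
    ∑ k, liftA l i m k • p k = ∑ k, m (j.succAbove k) • smallV p l i j k := by
  have h1 : ∑ k, m (j.succAbove k) • smallV p l i j k
      = ∑ k, m k • (if k = i then radonPt p l else p k) := by
    rw [Fin.sum_univ_succAbove _ j, hj, zero_smul, zero_add]
    rfl
  have h2 : ∑ k, m k • (if k = i then radonPt p l else p k)
      = m i • radonPt p l + ∑ k, (if k = i then 0 else m k) • p k := by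
    have : m i • radonPt p l = ∑ k, (if k = i then m k • radonPt p l else 0) := by simp
    rw [this, ← Finset.sum_add_distrib]
    exact Finset.sum_congr rfl fun k _ => by split_ifs <;> simp
  rw [h1, h2]
  simp only [liftA, add_smul, Finset.sum_add_distrib, radonPt, Finset.smul_sum, mul_smul]

/-- Data of a Radon dependency in general position. -/
structure RadonData {d : ℕ} (p : Fin (d + 2) → Fin d → ℝ) (l : Fin (d + 2) → ℝ) : Prop where
  sum0 : ∑ k, l k = 0
  vec0 : ∑ k, l k • p k = 0
  ne : ∀ k, l k ≠ 0
  pos1 : ∑ k, lpos l k = 1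
  uniq : ∀ a : Fin (d + 2) → ℝ, ∑ k, a k = 0 → ∑ k, a k • p k = 0 → ∃ s : ℝ, ∀ k, a k = s * l k

theorem RadonData.uniq' {d : ℕ} {p : Fin (d + 2) → Fin d → ℝ} {l : Fin (d + 2) → ℝ}
    (R : RadonData p l) (a b : Fin (d + 2) → ℝ) (h : ∑ k, a k = ∑ k, b k)
    (h' : ∑ k, a k • p k = ∑ k, b k • p k) : ∃ s : ℝ, ∀ k, a k = b k + s * l k := by
  obtain ⟨s, hs⟩ := R.uniq (fun k => a k - b k) (by simp [h]) (by simp [sub_smul, h'])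
  exact ⟨s, fun k => by linarith [hs k]⟩

theorem affInd_small {d : ℕ} {p : Fin (d + 2) → Fin d → ℝ} {l : Fin (d + 2) → ℝ}
    (R : RadonData p l) {i j : Fin (d + 2)} (hi : 0 < l i) (hj : l j < 0) :
    AffineIndependent ℝ (smallV p l i j) := by
  rw [affineIndependent_iff_of_fintype]
  intro c hc hv
  rw [Finset.weightedVSub_eq_linear_combination _ hc] at hv
  have hij : j ≠ i := by rintro rfl; linarith
  set m : Fin (d + 2) → ℝ := j.insertNth (α := fun _ => ℝ) 0 c with hm
  have hmj : m j = 0 := by simp [hm]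
  have hmk : ∀ k, m (j.succAbove k) = c k := by simp [hm]
  obtain ⟨s, hs⟩ := R.uniq (liftA l i m)
    (by rw [sum_liftA l i j m hmj R.pos1]; simpa [hmk] using hc)
    (by rw [sum_liftA_smul p l i j m hmj]; simpa [hmk] using hv)
  have h1 : s = 0 := by
    have := hs j
    simp only [liftA, lpos, max_eq_right hj.le, hij, if_false, hmj] at this
    simpa [hj.ne] using this
  subst h1
  have h2 : m i = 0 := by
    have := hs i
    simp only [liftA, lpos, max_eq_left hi.le, if_true] at this
    simpa [hi.ne'] using this
  intro k
  rw [← hmk]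
  have := hs (j.succAbove k)
  by_cases hk : j.succAbove k = i
  · rw [hk, h2]
  · simpa [liftA, h2, hk] using this

/-- The affine basis of the small simplex. -/
def smallBasis {d : ℕ} {p : Fin (d + 2) → Fin d → ℝ} {l : Fin (d + 2) → ℝ}
    (R : RadonData p l) {i j : Fin (d + 2)} (hi : 0 < l i) (hj : l j < 0) :
    AffineBasis (Fin (d + 1)) ℝ (Fin d → ℝ) :=
  ⟨smallV p l i j, affInd_small R hi hj,
    (affInd_small R hi hj).affineSpan_eq_top_iff_card_eq_finrank_add_one.2 (by simp)⟩

/-- Interior points: there is a representation whose ratios are strictly extremal at `i`, `j`. -/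
theorem interior_small {d : ℕ} {p : Fin (d + 2) → Fin d → ℝ} {l : Fin (d + 2) → ℝ}
    (R : RadonData p l) {i j : Fin (d + 2)} (hi : 0 < l i) (hj : l j < 0) {x : Fin d → ℝ}
    (hx : x ∈ interior (convexHull ℝ (Set.range (smallV p l i j)))) :
    ∃ a : Fin (d + 2) → ℝ, ∑ k, a k = 1 ∧ ∑ k, a k • p k = x ∧
      (∀ k, 0 < l k → k ≠ i → a i / l i < a k / l k) ∧
      (∀ k, l k < 0 → k ≠ j → a k / l k < a j / l j) := by
  have hij : j ≠ i := by rintro rfl; linarith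
  have hx' : x ∈ interior (convexHull ℝ (Set.range (smallBasis R hi hj))) := hx
  rw [AffineBasis.interior_convexHull] at hx'
  set b := smallBasis R hi hj with hb
  set c : Fin (d + 1) → ℝ := fun k => b.coord k x with hc
  have hc0 : ∀ k, 0 < c k := hx'
  have hc1 : ∑ k, c k = 1 := b.sum_coord_apply_eq_one x
  have hcx : ∑ k, c k • smallV p l i j k = x := b.linear_combination_coord_eq_self x
  set m : Fin (d + 2) → ℝ := j.insertNth (α := fun _ => ℝ) 0 c with hm
  have hmj : m j = 0 := by simp [hm]
  have hmk : ∀ k, m (j.succAbove k) = c k := by simp [hm]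
  have hmp : ∀ k, k ≠ j → 0 < m k := by
    intro k hk
    obtain ⟨k', rfl⟩ := Fin.exists_succAbove_eq hk
    rw [hmk]; exact hc0 _
  refine ⟨liftA l i m, ?_, ?_, ?_, ?_⟩
  · rw [sum_liftA l i j m hmj R.pos1]; simpa [hmk] using hc1
  · rw [sum_liftA_smul p l i j m hmj]; simpa [hmk] using hcx
  · intro k hk hki
    have hkj : k ≠ j := by rintro rfl; linarith
    have := hmp k hkj
    simp only [liftA, lpos, max_eq_left hi.le, max_eq_left hk.le, if_true, hki, if_false]
    rw [add_zero, mul_div_cancel_right₀ _ hi.ne', add_div, mul_div_cancel_right₀ _ hk.ne']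
    have := div_pos this hk
    linarith
  · intro k hk hkj
    have hki : k ≠ i := by rintro rfl; linarith
    have := hmp k hkj
    simp only [liftA, lpos, max_eq_right hj.le, max_eq_right hk.le, hki, if_false, hij, hmj]
    simp only [mul_zero, zero_add, zero_div]
    exact div_neg_of_pos_of_neg this hk

theorem disjoint_small {d : ℕ} {p : Fin (d + 2) → Fin d → ℝ} {l : Fin (d + 2) → ℝ}
    (R : RadonData p l) {i j i' j' : Fin (d + 2)} (hi : 0 < l i) (hj : l j < 0)
    (hi' : 0 < l i') (hj' : l j' < 0) {x : Fin d → ℝ}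
    (hx : x ∈ interior (convexHull ℝ (Set.range (smallV p l i j))))
    (hx' : x ∈ interior (convexHull ℝ (Set.range (smallV p l i' j')))) : i = i' ∧ j = j' := by
  obtain ⟨a, a1, ax, ai, aj⟩ := interior_small R hi hj hx
  obtain ⟨b, b1, bx, bi, bj⟩ := interior_small R hi' hj' hx'
  obtain ⟨s, hs⟩ := R.uniq' a b (a1.trans b1.symm) (ax.trans bx.symm)
  have hr : ∀ k, a k / l k = b k / l k + s := by
    intro k
    rw [hs, add_div, mul_div_cancel_right₀ _ (R.ne k)]
  constructor
  · by_contra h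
    have h1 := ai i' hi' (Ne.symm h)
    have h2 := bi i hi h
    rw [hr, hr] at h1
    linarith
  · by_contra h
    have h1 := aj j' hj' (Ne.symm h)
    have h2 := bj j hj h
    rw [hr, hr] at h1
    linarith

theorem cover_small {d : ℕ} {p : Fin (d + 2) → Fin d → ℝ} {l : Fin (d + 2) → ℝ}
    (R : RadonData p l) {x : Fin d → ℝ} (a : Fin (d + 2) → ℝ) (a0 : ∀ k, 0 ≤ a k)
    (a1 : ∑ k, a k = 1) (ax : ∑ k, a k • p k = x) :
    ∃ i j, 0 < l i ∧ l j < 0 ∧ x ∈ convexHull ℝ (Set.range (smallV p l i j)) := by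
  classical
  have hP : (Finset.univ.filter fun k => 0 < l k).Nonempty := by
    by_contra h
    rw [Finset.not_nonempty_iff_eq_empty, Finset.filter_eq_empty_iff] at h
    have : ∑ k, lpos l k = 0 := Finset.sum_eq_zero fun k _ => by
      simpa [lpos] using h (Finset.mem_univ k)
    linarith [R.pos1]
  have hN : (Finset.univ.filter fun k => l k < 0).Nonempty := by
    by_contra h
    rw [Finset.not_nonempty_iff_eq_empty, Finset.filter_eq_empty_iff] at h
    have : ∑ k, lpos l k = ∑ k, l k := Finset.sum_congr rfl fun k _ => by
      simpa [lpos] using h (Finset.mem_univ k)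
    linarith [R.pos1, R.sum0]
  obtain ⟨i, hi, hmin⟩ := Finset.exists_min_image _ (fun k => a k / l k) hP
  obtain ⟨j, hj, hmax⟩ := Finset.exists_max_image _ (fun k => a k / l k) hN
  simp only [Finset.mem_filter, Finset.mem_univ, true_and] at hi hmin hj hmax
  have hij : j ≠ i := by rintro rfl; linarith
  refine ⟨i, j, hi, hj, ?_⟩
  -- shifted coefficients
  set s : ℝ := a j / l j with hs
  set m : Fin (d + 2) → ℝ := fun k => if k = i then a i / l i - s else
    a k - s * l k - (a i / l i - s) * lpos l k with hm
  have hmj : m j = 0 := by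
    simp only [hm, hij, if_false, lpos, max_eq_right hj.le, hs]
    rw [div_mul_cancel₀ _ hj.ne]; ring
  have hlift : ∀ k, liftA l i m k = a k - s * l k := by
    intro k
    by_cases hk : k = i
    · subst hk
      simp only [liftA, hm, if_true, lpos, max_eq_left hi.le]
      field_simp
      ring
    · simp only [liftA, hm, if_true, hk, if_false]; ring
  have hs0 : s ≤ 0 := div_nonpos_of_nonneg_of_nonpos (a0 j) hj.le
  have hm0 : ∀ k, 0 ≤ m k := by
    intro k
    by_cases hk : k = i
    · subst hk
      simp only [hm, if_true]
      have := div_nonneg (a0 k) hi.le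
      linarith
    · simp only [hm, hk, if_false]
      rcases lt_or_gt_of_ne (R.ne k) with h | h
      · have := hmax k h
        rw [div_le_iff_of_neg h] at this
        simp only [lpos, max_eq_right h.le]
        linarith
      · have := hmin k h
        rw [le_div_iff₀ h] at this
        simp only [lpos, max_eq_left h.le]
        linarith
  rw [mem_hull_range]
  refine ⟨fun k => m (j.succAbove k), fun k => hm0 _, ?_, ?_⟩
  · rw [← sum_liftA l i j m hmj R.pos1]
    simp only [hlift, Finset.sum_sub_distrib, ← Finset.mul_sum, R.sum0, a1]; ring
  · rw [← sum_liftA_smul p l i j m hmj]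
    simp only [hlift, sub_smul, Finset.sum_sub_distrib, mul_smul, ← Finset.smul_sum, R.vec0, ax]
    simp

theorem snoc_mem_hull {d : ℕ} (v : Fin (d + 2) → Fin (d + 1) → ℝ) (x : Fin d → ℝ) (t : ℝ) :
    (Fin.snoc x t : Fin (d + 1) → ℝ) ∈ convexHull ℝ (Set.range v) ↔
      ∃ a : Fin (d + 2) → ℝ, (∀ k, 0 ≤ a k) ∧ ∑ k, a k = 1 ∧
        ∑ k, a k • proj d (v k) = x ∧ ∑ k, a k * v k (Fin.last d) = t := by
  rw [mem_hull_range]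
  refine exists_congr fun a => and_congr_right fun _ => and_congr_right fun _ => ?_
  constructor
  · intro h
    constructor
    · ext q
      have := congrFun h q.castSucc
      simpa [Finset.sum_apply, proj] using this
    · have := congrFun h (Fin.last d)
      simpa [Finset.sum_apply] using this
  · rintro ⟨rfl, rfl⟩
    ext q
    refine Fin.lastCases ?_ (fun q => ?_) q
    · simp [Finset.sum_apply]
    · simp [Finset.sum_apply, proj]

theorem simplexFn_small {d : ℕ} (v : Fin (d + 2) → Fin (d + 1) → ℝ) {l : Fin (d + 2) → ℝ}
    (R : RadonData (fun k => proj d (v k)) l) {i j : Fin (d + 2)} (hi : 0 < l i) (hj : l j < 0)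
    (x : Fin d → ℝ)
    (hx : x ∈ convexHull ℝ (Set.range (smallV (fun k => proj d (v k)) l i j)))
    (i' : Fin (d + 1)) (hi' : j.succAbove i' = i) :
    simplexFn d v x = |∑ k, l k * v k (Fin.last d)| * (smallBasis R hi hj).coord i' x := by
  have hij : j ≠ i := by rintro rfl; linarith
  have hx' : x ∈ convexHull ℝ (Set.range (smallBasis R hi hj)) := hx
  rw [AffineBasis.convexHull_eq_nonneg_coord] at hx'
  set b := smallBasis R hi hj with hb
  set c : Fin (d + 1) → ℝ := fun k => b.coord k x with hc
  have hc0 : ∀ k, 0 ≤ c k := hx'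
  have hc1 : ∑ k, c k = 1 := b.sum_coord_apply_eq_one x
  have hcx : ∑ k, c k • smallV (fun k => proj d (v k)) l i j k = x :=
    b.linear_combination_coord_eq_self x
  set m : Fin (d + 2) → ℝ := j.insertNth (α := fun _ => ℝ) 0 c with hm
  have hmj : m j = 0 := by simp [hm]
  have hmk : ∀ k, m (j.succAbove k) = c k := by simp [hm]
  have hm0 : ∀ k, 0 ≤ m k := by
    intro k
    by_cases hk : k = j
    · rw [hk, hmj]
    obtain ⟨k', rfl⟩ := Fin.exists_succAbove_eq hk
    rw [hmk]; exact hc0 _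
  have hmi : m i = b.coord i' x := by rw [← hi', hmk]
  have A1 : ∑ k, liftA l i m k = 1 := by
    rw [sum_liftA l i j m hmj R.pos1]; simpa [hmk] using hc1
  have Ax : ∑ k, liftA l i m k • proj d (v k) = x := by
    rw [sum_liftA_smul (fun k => proj d (v k)) l i j m hmj]; simpa [hmk] using hcx
  set H := ∑ k, l k * v k (Fin.last d) with hH
  set T := ∑ k, liftA l i m k * v k (Fin.last d) with hT
  have key : {t : ℝ | (Fin.snoc x t : Fin (d + 1) → ℝ) ∈ convexHull ℝ (Set.range v)}
      = (fun t => T + t) '' ((fun s => s * H) '' Set.uIcc (-(m i)) 0) := by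
    rw [Set.image_image, Set.uIcc_of_le (by linarith [hm0 i])]
    ext t
    rw [Set.mem_ofPred_eq, snoc_mem_hull]
    constructor
    · rintro ⟨a, a0, a1, ax, rfl⟩
      obtain ⟨s, hs⟩ := R.uniq' a (liftA l i m) (a1.trans A1.symm) (ax.trans Ax.symm)
      refine ⟨s, ⟨?_, ?_⟩, ?_⟩
      · have h1 := a0 i
        rw [hs] at h1
        simp only [liftA, lpos, max_eq_left hi.le, if_true] at h1
        have : 0 ≤ (m i + s) * l i := by linarith
        have := nonneg_of_mul_nonneg_left this hi
        linarith
      · have h1 := a0 j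
        rw [hs] at h1
        simp only [liftA, lpos, max_eq_right hj.le, hij, if_false, hmj] at h1
        by_contra h
        push Not at h
        have := mul_neg_of_pos_of_neg h hj
        linarith
      · simp only [hs, add_mul, Finset.sum_add_distrib, hT, hH, Finset.mul_sum, mul_assoc]
    · rintro ⟨s, ⟨h1, h2⟩, rfl⟩
      refine ⟨fun k => liftA l i m k + s * l k, ?_, ?_, ?_, ?_⟩
      · intro k
        have h3 : 0 ≤ if k = i then 0 else m k := by
          split_ifs
          · exact le_rfl
          · exact hm0 k
        simp only [liftA]
        rcases lt_or_gt_of_ne (R.ne k) with h | h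
        · simp only [lpos, max_eq_right h.le]
          have := mul_nonneg_of_nonpos_of_nonpos h2 h.le
          linarith
        · simp only [lpos, max_eq_left h.le]
          have : 0 ≤ (m i + s) * l k := mul_nonneg (by linarith) h.le
          linarith
      · simp only [Finset.sum_add_distrib, ← Finset.mul_sum, A1, R.sum0]; ring
      · have := R.vec0
        simp only [add_smul, Finset.sum_add_distrib, Ax, mul_smul, ← Finset.smul_sum, this]
        simp
      · simp only [add_mul, Finset.sum_add_distrib, hT, hH, Finset.mul_sum, mul_assoc]
  rw [simplexFn, key, Set.image_mul_const_uIcc, Set.image_const_add_uIcc, Real.volume_interval,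
    ENNReal.toReal_ofReal (abs_nonneg _), ← hmi]
  have : T + 0 * H - (T + -(m i) * H) = H * m i := by ring
  rw [this, abs_mul, abs_of_nonneg (hm0 i)]

theorem exists_radon {d : ℕ} (p : Fin (d + 2) → Fin d → ℝ)
    (hp : ∀ i : Fin (d + 2), AffineIndependent ℝ (fun j : {j : Fin (d + 2) // j ≠ i} => p j.1)) :
    ∃ l, RadonData p l := by
  classical
  have K : ∀ a : Fin (d + 2) → ℝ, ∑ k, a k = 0 → ∑ k, a k • p k = 0 →
      ∀ i, a i = 0 → ∀ k, a k = 0 := by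
    intro a a0 av i hi k
    by_cases hk : k = i
    · rw [hk, hi]
    have h1 : ∑ k : {k // k ≠ i}, a k.1 = 0 := by
      rw [Fintype.sum_eq_add_sum_subtype_ne _ i, hi, zero_add] at a0
      exact a0
    have h2 : ∑ k : {k // k ≠ i}, a k.1 • p k.1 = 0 := by
      rw [Fintype.sum_eq_add_sum_subtype_ne _ i, hi, zero_smul, zero_add] at av
      exact av
    exact (affineIndependent_iff.1 (hp i)) Finset.univ (fun k => a k.1) h1 h2 ⟨k, hk⟩
      (Finset.mem_univ _)
  let f : (Fin (d + 2) → ℝ) →ₗ[ℝ] ((Fin d → ℝ) × ℝ) :=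
    (Fintype.linearCombination ℝ p).prod (Fintype.linearCombination ℝ (fun _ => (1 : ℝ)))
  have hf : LinearMap.ker f ≠ ⊥ := LinearMap.ker_ne_bot_of_finrank_lt (by simp)
  obtain ⟨l0, hl0, hne⟩ := (Submodule.ne_bot_iff _).1 hf
  have h0 : ∑ k, l0 k • p k = 0 ∧ ∑ k, l0 k = 0 := by
    simpa [f, Fintype.linearCombination_apply] using hl0
  obtain ⟨hv, hs⟩ := h0
  have hn : ∀ k, l0 k ≠ 0 := fun k hk => hne (funext fun q => K l0 hs hv k hk q)
  have hS : 0 < ∑ k, lpos l0 k := by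
    refine lt_of_le_of_ne (Finset.sum_nonneg fun k _ => le_max_right _ _) fun h => ?_
    have h1 := (Finset.sum_eq_zero_iff_of_nonneg (fun k _ => le_max_right (l0 k) 0)).1 h.symm
    have h2 : ∀ k, l0 k ≤ 0 := fun k => by simpa using h1 k (Finset.mem_univ k)
    exact hn 0 ((Finset.sum_eq_zero_iff_of_nonpos (fun k _ => h2 k)).1 hs 0 (Finset.mem_univ _))
  set S := ∑ k, lpos l0 k with hSdef
  refine ⟨fun k => S⁻¹ * l0 k, ?_, ?_, ?_, ?_, ?_⟩
  · rw [← Finset.mul_sum, hs, mul_zero]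
  · simp only [mul_smul, ← Finset.smul_sum, hv, smul_zero]
  · exact fun k => mul_ne_zero (inv_ne_zero hS.ne') (hn k)
  · have : ∀ k, lpos (fun k => S⁻¹ * l0 k) k = S⁻¹ * lpos l0 k := by
      intro k
      simp only [lpos]
      rw [mul_max_of_nonneg _ _ (inv_nonneg.2 hS.le), mul_zero]
    simp only [this, ← Finset.mul_sum, ← hSdef]
    exact inv_mul_cancel₀ hS.ne'
  · intro a a0 av
    have := K (fun k => a k - a 0 / l0 0 * l0 k)
      (by simp only [Finset.sum_sub_distrib, ← Finset.mul_sum, a0, hs]; ring)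
      (by simp only [sub_smul, Finset.sum_sub_distrib, mul_smul, ← Finset.smul_sum, av, hv]; simp)
      0 (by simp only [div_mul_cancel₀ _ (hn 0), sub_self])
    refine ⟨a 0 / l0 0 * S, fun k => ?_⟩
    have := this k
    rw [mul_assoc, mul_inv_cancel_left₀ hS.ne']
    linarith

/-- `τ(Δ)` lies in `PL(d, d²)`: there are at most `d²` full-dimensional `d`-simplices in
`ℝ^d` with pairwise disjoint interiors on each of which `τ(Δ)` is affine, and `τ(Δ)` vanishes
outside their union. -/
theorem simplexFn_mem_PL (d : ℕ) (hd : 2 ≤ d)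
    (v : Fin (d + 2) → (Fin (d + 1) → ℝ)) (hv : IsNondegSimplex d v) :
    ∃ (m : ℕ) (_ : m ≤ d ^ 2) (w : Fin m → Fin (d + 1) → (Fin d → ℝ)),
      (∀ i, AffineIndependent ℝ (w i)) ∧
      (Pairwise fun i j =>
        interior (convexHull ℝ (Set.range (w i))) ∩
          interior (convexHull ℝ (Set.range (w j))) = ∅) ∧
      (∀ i, ∃ g : (Fin d → ℝ) →ᵃ[ℝ] ℝ,
        ∀ x ∈ convexHull ℝ (Set.range (w i)), simplexFn d v x = g x) ∧
      (∀ x : Fin d → ℝ, x ∉ ⋃ i, convexHull ℝ (Set.range (w i)) → simplexFn d v x = 0) := by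
  classical
  obtain ⟨l, R⟩ := exists_radon (fun k => proj d (v k)) hv.2
  set P := Finset.univ.filter fun k => 0 < l k with hP
  set N := Finset.univ.filter fun k => ¬ (0 < l k) with hN
  have hPN : P.card + N.card = d + 2 := by
    rw [hP, hN, Finset.card_filter_add_card_filter_not]; simp
  have hcard : (P ×ˢ N).card ≤ d ^ 2 := by
    rw [Finset.card_product]
    have h1 : 4 * (P.card * N.card) ≤ (P.card + N.card) ^ 2 := by
      zify
      nlinarith [sq_nonneg ((P.card : ℤ) - N.card)]
    rw [hPN] at h1
    nlinarith
  let e := (P ×ˢ N).equivFin.symm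
  have hpos : ∀ q, 0 < l (e q).1.1 := fun q => by
    have := (Finset.mem_product.1 (e q).2).1
    simpa [hP] using this
  have hneg : ∀ q, l (e q).1.2 < 0 := fun q => by
    have := (Finset.mem_product.1 (e q).2).2
    have h : l (e q).1.2 ≤ 0 := by simpa [hN] using this
    exact lt_of_le_of_ne h (R.ne _)
  refine ⟨(P ×ˢ N).card, hcard,
    fun q => smallV (fun k => proj d (v k)) l (e q).1.1 (e q).1.2, ?_, ?_, ?_, ?_⟩
  · exact fun q => affInd_small R (hpos q) (hneg q)
  · intro q q' hqq
    rw [Set.eq_empty_iff_forall_notMem]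
    rintro x ⟨h1, h2⟩
    obtain ⟨h3, h4⟩ := disjoint_small R (hpos q) (hneg q) (hpos q') (hneg q') h1 h2
    exact hqq (e.injective (Subtype.ext (Prod.ext h3 h4)))
  · intro q
    have hij : (e q).1.1 ≠ (e q).1.2 := by
      intro h
      have h1 := hpos q
      have h2 := hneg q
      rw [h] at h1
      linarith
    obtain ⟨i', hi'⟩ := Fin.exists_succAbove_eq hij
    refine ⟨|∑ k, l k * v k (Fin.last d)| • (smallBasis R (hpos q) (hneg q)).coord i', ?_⟩
    intro x hx
    rw [simplexFn_small v R (hpos q) (hneg q) x hx i' hi']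
    simp
  · intro x hx
    have : {t : ℝ | (Fin.snoc x t : Fin (d + 1) → ℝ) ∈ convexHull ℝ (Set.range v)} = ∅ := by
      rw [Set.eq_empty_iff_forall_notMem]
      intro t ht
      rw [Set.mem_ofPred_eq, snoc_mem_hull] at ht
      obtain ⟨a, a0, a1, ax, -⟩ := ht
      obtain ⟨i, j, hi, hj, hm⟩ := cover_small R a a0 a1 ax
      apply hx
      rw [Set.mem_iUnion]
      have hmem : (i, j) ∈ P ×ˢ N := by
        rw [Finset.mem_product]
        exact ⟨by simpa [hP] using hi, by simpa [hN] using hj.le⟩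
      refine ⟨e.symm ⟨(i, j), hmem⟩, ?_⟩
      beta_reduce
      rw [Equiv.apply_symm_apply]
      exact hm
    rw [simplexFn, this]
    simp
end
end

section
/- Let K ⊂ ℝ^{d+1} be a compact set that is the union of finitely many nondegenerate (d+1)-simplices Δ_1, …, Δ_m with pairwise disjoint interiors. Then for every x ∈ ℝ^d, the 1-dimensional Lebesgue measure of ℓ_x ∩ K equals the sum Σ_{i=1}^m τ(Δ_i)(x). In particular, if a nondegenerate (d+1)-simplex Δ is the union of nondegenerate (d+1)-simplices Δ_1, …, Δ_m with pairwise disjoint interiors, then τ(Δ) = Σ_{i=1}^m τ(Δ_i). -/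
open MeasureTheory

noncomputable section

lemma fiber_aux (d : ℕ) (v : Fin (d + 2) → (Fin (d + 1) → ℝ)) (hv : IsNondegSimplex d v)
    (p q : Fin (d + 1) → ℝ) (hp : p ∈ convexHull ℝ (Set.range v))
    (hq : q ∈ convexHull ℝ (Set.range v)) (hpq : proj d p = proj d q) (hne : p ≠ q) :
    AffineMap.lineMap p q (1 / 2 : ℝ) ∈ interior (convexHull ℝ (Set.range v)) := by
  obtain ⟨hi, hf⟩ := hv
  have tot : affineSpan ℝ (Set.range v) = ⊤ := by
    rw [hi.affineSpan_eq_top_iff_card_eq_finrank_add_one]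
    simp
  let b : AffineBasis (Fin (d + 2)) ℝ (Fin (d + 1) → ℝ) := ⟨v, hi, tot⟩
  have hb : ∀ i, b i = v i := fun i => rfl
  have hr : Set.range v = Set.range b := rfl
  rw [hr, b.convexHull_eq_nonneg_coord] at hp hq
  rw [hr, b.interior_convexHull]
  intro i
  have hp' : ∀ i, 0 ≤ b.coord i p := hp
  have hq' : ∀ i, 0 ≤ b.coord i q := hq
  rw [AffineMap.apply_lineMap, AffineMap.lineMap_apply_ring']
  by_contra hcon
  have hpi : b.coord i p = 0 := by linarith [hp' i, hq' i]
  have hqi : b.coord i q = 0 := by linarith [hp' i, hq' i]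
  have e1 : ∑ j : {j // j ≠ i}, (b.coord j.1 p - b.coord j.1 q) = 0 := by
    have := Fintype.sum_eq_add_sum_subtype_ne (fun j => b.coord j p - b.coord j q) i
    simp only [Finset.sum_sub_distrib, b.sum_coord_apply_eq_one, hpi, hqi] at this
    rw [Finset.sum_sub_distrib]
    linarith
  have e2 : ∑ j : {j // j ≠ i}, (b.coord j.1 p - b.coord j.1 q) • proj d (v j.1) = 0 := by
    have h := Fintype.sum_eq_add_sum_subtype_ne
      (fun j => (b.coord j p - b.coord j q) • proj d (v j)) i
    rw [hpi, hqi, sub_self, zero_smul, zero_add] at h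
    rw [← h]
    have h1 := b.linear_combination_coord_eq_self p
    have h2 := b.linear_combination_coord_eq_self q
    ext k
    have h1k := congrFun h1 k.castSucc
    have h2k := congrFun h2 k.castSucc
    have h3k := congrFun hpq k
    simp only [proj, Finset.sum_apply, Pi.smul_apply, smul_eq_mul, sub_mul,
      Finset.sum_sub_distrib, Pi.zero_apply, hb] at h1k h2k h3k ⊢
    linarith
  have e3 := (affineIndependent_iff.1 (hf i)) Finset.univ _ e1 e2
  apply hne
  rw [← b.linear_combination_coord_eq_self p, ← b.linear_combination_coord_eq_self q]
  refine Finset.sum_congr rfl fun j _ => ?_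
  congr 1
  by_cases hj : j = i
  · rw [hj, hpi, hqi]
  · linarith [e3 ⟨j, hj⟩ (Finset.mem_univ _)]

lemma continuous_fiber (d : ℕ) (x : Fin d → ℝ) :
    Continuous (fun t : ℝ => (Fin.snoc x t : Fin (d + 1) → ℝ)) := by
  refine continuous_pi fun i => ?_
  refine Fin.lastCases ?_ (fun j => ?_) i
  · simpa using continuous_id'
  · simpa using continuous_const

lemma isCompact_hull (d : ℕ) (v : Fin (d + 2) → (Fin (d + 1) → ℝ)) :
    IsCompact (convexHull ℝ (Set.range v)) :=
  (Set.finite_range v).isCompact_convexHull (𝕜 := ℝ)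

lemma fiber_finite (d : ℕ) (v : Fin (d + 2) → (Fin (d + 1) → ℝ)) (x : Fin d → ℝ) :
    volume {t : ℝ | (Fin.snoc x t : Fin (d + 1) → ℝ) ∈ convexHull ℝ (Set.range v)} ≠ ⊤ := by
  have hb : Bornology.IsBounded ((fun y : Fin (d + 1) → ℝ => y (Fin.last d)) ''
      convexHull ℝ (Set.range v)) :=
    ((isCompact_hull d v).image (continuous_apply _)).isBounded
  refine (lt_of_le_of_lt (measure_mono ?_) hb.measure_lt_top).ne
  intro t ht
  exact ⟨_, ht, by simp⟩

/-- If `K` is a finite union of nondegenerate `(d+1)`-simplices with pairwise disjoint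
interiors, then the length of the vertical fiber of `K` over any `x` is the sum of the
simplex functions; in particular if a nondegenerate simplex is such a union then its simplex
function is the sum of those of the pieces. -/
theorem fiber_length_union_eq_sum (d m : ℕ)
    (w : Fin m → Fin (d + 2) → (Fin (d + 1) → ℝ))
    (hw : ∀ i, IsNondegSimplex d (w i))
    (hdisj : Pairwise fun i j =>
      interior (convexHull ℝ (Set.range (w i))) ∩
        interior (convexHull ℝ (Set.range (w j))) = ∅) :
    (∀ x : Fin d → ℝ,
      (volume {t : ℝ | Fin.snoc x t ∈ ⋃ i, convexHull ℝ (Set.range (w i))}).toReal =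
        ∑ i, simplexFn d (w i) x) ∧
    (∀ v : Fin (d + 2) → (Fin (d + 1) → ℝ), IsNondegSimplex d v →
      convexHull ℝ (Set.range v) = ⋃ i, convexHull ℝ (Set.range (w i)) →
      ∀ x : Fin d → ℝ, simplexFn d v x = ∑ i, simplexFn d (w i) x) := by
  have main : ∀ x : Fin d → ℝ,
      (volume {t : ℝ | Fin.snoc x t ∈ ⋃ i, convexHull ℝ (Set.range (w i))}).toReal =
        ∑ i, simplexFn d (w i) x := by
    intro x
    have hU : {t : ℝ | (Fin.snoc x t : Fin (d + 1) → ℝ) ∈ ⋃ i, convexHull ℝ (Set.range (w i))} =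
        ⋃ i, {t : ℝ | (Fin.snoc x t : Fin (d + 1) → ℝ) ∈ convexHull ℝ (Set.range (w i))} := by
      ext t
      simp only [Set.mem_ofPred_eq, Set.mem_iUnion]
    rw [hU, measure_iUnion₀, tsum_fintype, ENNReal.toReal_sum]
    · rfl
    · exact fun i _ => fiber_finite d (w i) x
    · intro i j hij
      refine Set.Subsingleton.measure_zero ?_ _
      intro s hs t ht
      by_contra hst
      have hne : (Fin.snoc x s : Fin (d + 1) → ℝ) ≠ Fin.snoc x t := by
        intro h
        have := congrFun h (Fin.last d)
        simp only [Fin.snoc_last] at this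
        exact hst this
      have hp : proj d (Fin.snoc x s) = proj d (Fin.snoc x t) := by
        ext k
        simp [proj]
      have := hdisj hij
      replace this := Set.eq_empty_iff_forall_notMem.1 this
      exact this _ ⟨fiber_aux d _ (hw i) _ _ hs.1 ht.1 hp hne,
        fiber_aux d _ (hw j) _ _ hs.2 ht.2 hp hne⟩
    · intro i
      exact (((isCompact_hull d (w i)).isClosed.preimage
        (continuous_fiber d x)).measurableSet).nullMeasurableSet
  refine ⟨main, fun v _ hvK x => ?_⟩
  rw [← main x, ← hvK]
  rfl
end
end

section
/- Let f ∈ PL(d,n), i.e. f : ℝ^d → ℝ is a continuous compactly supported function that is affine on each of at most n d-simplices with pairwise disjoint interiors and zero outside their union. Then there exist an integer m with m ≤ 2n, nondegenerate (d+1)-simplices Δ_1, …, Δ_m in ℝ^{d+1}, and signs ε_1, …, ε_m ∈ {−1, +1} such that for every x ∈ ℝ^d one has f(x) = Σ_{i=1}^m ε_i τ(Δ_i)(x). -/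
open MeasureTheory

noncomputable section

/-- `f ∈ PL(d,n)`: `f : ℝ^d → ℝ` is continuous with compact support, and there are at most
`n` full-dimensional `d`-simplices in `ℝ^d` with pairwise disjoint interiors such that `f`
is affine on each of them and vanishes outside their union. -/
def IsPL (d n : ℕ) (f : (Fin d → ℝ) → ℝ) : Prop :=
  Continuous f ∧ HasCompactSupport f ∧
    ∃ (m : ℕ) (_ : m ≤ n) (w : Fin m → Fin (d + 1) → (Fin d → ℝ)),
      (∀ i, AffineIndependent ℝ (w i)) ∧
      (Pairwise fun i j =>
        interior (convexHull ℝ (Set.range (w i))) ∩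
          interior (convexHull ℝ (Set.range (w j))) = ∅) ∧
      (∀ i, ∃ g : (Fin d → ℝ) →ᵃ[ℝ] ℝ,
        ∀ x ∈ convexHull ℝ (Set.range (w i)), f x = g x) ∧
      (∀ x : Fin d → ℝ, x ∉ ⋃ i, convexHull ℝ (Set.range (w i)) → f x = 0)

/-- Lift of a point to the graph of an affine function, as an affine map. -/
def graphMap (d : ℕ) (a : (Fin d → ℝ) →ᵃ[ℝ] ℝ) : (Fin d → ℝ) →ᵃ[ℝ] (Fin (d + 1) → ℝ) where
  toFun y := Fin.snoc (α := fun _ => ℝ) y (a y)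
  linear :=
    { toFun := fun v => Fin.snoc (α := fun _ => ℝ) v (a.linear v)
      map_add' := by
        intro u v
        ext i
        refine Fin.lastCases ?_ (fun i => ?_) i <;> simp
      map_smul' := by
        intro c v
        ext i
        refine Fin.lastCases ?_ (fun i => ?_) i <;> simp }
  map_vadd' := by
    intro p v
    ext i
    refine Fin.lastCases ?_ (fun i => ?_) i
    · simp [-vadd_eq_add, AffineMap.map_vadd]
    · simp

theorem graphMap_apply (d : ℕ) (a : (Fin d → ℝ) →ᵃ[ℝ] ℝ) (y : Fin d → ℝ) :
    graphMap d a y = Fin.snoc (α := fun _ => ℝ) y (a y) := rfl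

/-- Vertices of the cone with apex `(q,s)` over the graph of `a` on the simplex `w`. -/
def coneV (d : ℕ) (w : Fin (d + 1) → Fin d → ℝ) (a : (Fin d → ℝ) →ᵃ[ℝ] ℝ)
    (q : Fin d → ℝ) (s : ℝ) : Fin (d + 2) → (Fin (d + 1) → ℝ) :=
  Fin.cons (α := fun _ => (Fin (d + 1) → ℝ)) (Fin.snoc (α := fun _ => ℝ) q s)
    (fun j => graphMap d a (w j))

/-- Parameters `l` for which `x` lies in the homothetic copy `(1-l) q + l S`. -/
def parSet (d : ℕ) (S : Set (Fin d → ℝ)) (q x : Fin d → ℝ) : Set ℝ :=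
  {l | 0 ≤ l ∧ l ≤ 1 ∧ ∃ y ∈ S, x = (1 - l) • q + l • y}

theorem simplexFn_coneV (d : ℕ) (w : Fin (d + 1) → Fin d → ℝ) (a : (Fin d → ℝ) →ᵃ[ℝ] ℝ)
    (q : Fin d → ℝ) (s : ℝ) (hs : s - a q ≠ 0) (x : Fin d → ℝ) :
    simplexFn d (coneV d w a q s) x =
      |s - a q| * (volume (parSet d (convexHull ℝ (Set.range w)) q x)).toReal := by
  have key : {t : ℝ | Fin.snoc (α := fun _ => ℝ) x t ∈ convexHull ℝ (Set.range (coneV d w a q s))}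
      = (fun t => (-(s - a q)⁻¹) * t) ⁻¹' ((fun t => t + (1 + a x / (s - a q))) ⁻¹'
        (parSet d (convexHull ℝ (Set.range w)) q x)) := by
    have h1 : convexHull ℝ (Set.range (coneV d w a q s)) =
        convexJoin ℝ {Fin.snoc (α := fun _ => ℝ) q s}
          (graphMap d a '' convexHull ℝ (Set.range w)) := by
      unfold coneV
      rw [Fin.range_cons, convexHull_insert (Set.range_nonempty _), AffineMap.image_convexHull,
        ← Set.range_comp]
      rfl
    ext t
    rw [h1]
    simp only [Set.mem_ofPred_eq, Set.mem_preimage, parSet, mem_convexJoin, Set.mem_singleton_iff,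
      exists_eq_left, Set.exists_mem_image]
    have hl : ∀ l : ℝ, (-(s - a q)⁻¹) * t + (1 + a x / (s - a q)) = l ↔
        t = a x + (1 - l) * (s - a q) := by
      intro l
      constructor
      · rintro rfl
        field_simp
        ring
      · rintro rfl
        field_simp
        ring
    have hcoord : ∀ (l : ℝ) (y : Fin d → ℝ),
        ((1 - l) • (Fin.snoc (α := fun _ => ℝ) q s : Fin (d + 1) → ℝ) + l • graphMap d a y =
          Fin.snoc (α := fun _ => ℝ) x t) ↔
        (x = (1 - l) • q + l • y ∧ t = a x + (1 - l) * (s - a q)) := by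
      intro l y
      have hh : (x = (1 - l) • q + l • y) → a x = (1 - l) * a q + l * a y := by
        rintro rfl
        rw [Convex.combo_affine_apply (by ring)]
        simp
      constructor
      · intro h
        have hx : x = (1 - l) • q + l • y := by
          ext i
          have := congrFun h i.castSucc
          simp [graphMap_apply] at this
          simp [this]
        refine ⟨hx, ?_⟩
        have := congrFun h (Fin.last d)
        simp [graphMap_apply] at this
        rw [hh hx, ← this]
        ring
      · rintro ⟨hx, ht⟩
        ext i
        refine Fin.lastCases ?_ (fun i => ?_) i
        · simp [graphMap_apply]
          rw [ht, hh hx]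
          ring
        · simp [graphMap_apply]
          have := congrFun hx i
          simpa using this.symm
    constructor
    · rintro ⟨y, hy, ⟨b, l, hb, hl0, hbl, h⟩⟩
      obtain rfl : b = 1 - l := by linarith
      obtain ⟨hx, ht⟩ := (hcoord l y).1 h
      rw [(hl l).2 ht]
      exact ⟨hl0, by linarith, y, hy, hx⟩
    · generalize hL : (-(s - a q)⁻¹) * t + (1 + a x / (s - a q)) = l
      rintro ⟨h0, h1, y, hy, hx⟩
      exact ⟨y, hy, 1 - l, l, by linarith, h0, by ring, (hcoord l y).2 ⟨hx, (hl l).1 hL⟩⟩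
  unfold simplexFn
  rw [key, Real.volume_preimage_mul_left (by simpa using hs), measure_preimage_add_right,
    ENNReal.toReal_mul, ENNReal.toReal_ofReal (abs_nonneg _), inv_neg, inv_inv, abs_neg]

theorem affineIndependent_congr {ι : Type*} {k : ℕ} {p p' : ι → (Fin k → ℝ)}
    (h : AffineIndependent ℝ p) (e : ∀ j, p' j = p j) : AffineIndependent ℝ p' := by
  obtain rfl : p' = p := funext e
  exact h

theorem proj_snoc (d : ℕ) (q : Fin d → ℝ) (s : ℝ) :
    proj d (Fin.snoc (α := fun _ => ℝ) q s) = q := by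
  ext i
  simp [proj]

theorem affineIndependent_update {d : ℕ} (b : AffineBasis (Fin (d + 1)) ℝ (Fin d → ℝ))
    (q : Fin d → ℝ) (k : Fin (d + 1)) (hk : b.coord k q ≠ 0) :
    AffineIndependent ℝ (Function.update (⇑b) k q) := by
  apply AffineIndependent.affineIndependent_of_notMem_span (i := k)
  · have := b.ind.comp_embedding (Function.Embedding.subtype (fun y => y ≠ k))
    refine affineIndependent_congr this fun j => ?_
    exact Function.update_of_ne j.2 _ _
  · intro h
    apply hk
    have : affineSpan ℝ (Function.update (⇑b) k q '' {x | x ≠ k}) ≤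
        (affineSpan ℝ {(0:ℝ)}).comap (b.coord k) := by
      rw [affineSpan_le]
      rintro _ ⟨j, hj, rfl⟩
      have hj' : j ≠ k := hj
      simp [Function.update_of_ne hj', b.coord_apply_ne hj'.symm]
    have := this h
    simpa using this

theorem coneV_nondeg {d : ℕ} (b : AffineBasis (Fin (d + 1)) ℝ (Fin d → ℝ))
    (a : (Fin d → ℝ) →ᵃ[ℝ] ℝ) (q : Fin d → ℝ) (s : ℝ) (hs : s - a q ≠ 0)
    (hq : ∀ k, b.coord k q ≠ 0) : IsNondegSimplex d (coneV d b a q s) := by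
  have hpr : ∀ j, proj d (coneV d b a q s j) = Fin.cons (α := fun _ => Fin d → ℝ) q b j := by
    intro j
    refine Fin.cases ?_ (fun j => ?_) j
    · simp [coneV, proj_snoc]
    · simp [coneV, graphMap_apply, proj_snoc]
  constructor
  · apply AffineIndependent.affineIndependent_of_notMem_span (i := 0)
    · have hinj : Function.Injective (graphMap d a) := by
        intro y z h
        have := congrArg (proj d) h
        simpa [graphMap_apply, proj_snoc] using this
      have h2 := b.ind.map' (graphMap d a) hinj
      have h3 := h2.comp_embedding
        (⟨fun j : {y : Fin (d + 2) // y ≠ 0} => j.1.pred j.2, by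
          intro i j h
          exact Subtype.ext (Fin.pred_inj.1 h)⟩ : {y : Fin (d + 2) // y ≠ 0} ↪ Fin (d + 1))
      refine affineIndependent_congr h3 fun j => ?_
      obtain ⟨j, hj⟩ := j
      obtain ⟨k, rfl⟩ := Fin.exists_succ_eq.2 hj
      rfl
    · intro h
      have : affineSpan ℝ (coneV d b a q s '' {x | x ≠ 0}) ≤
          (⊤ : AffineSubspace ℝ (Fin d → ℝ)).map (graphMap d a) := by
        rw [affineSpan_le]
        rintro _ ⟨j, hj, rfl⟩
        obtain ⟨k, rfl⟩ := Fin.exists_succ_eq.2 hj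
        simp [coneV]
      obtain ⟨y, -, hy⟩ := this h
      have h1 := congrArg (proj d) hy
      have h2 := congrFun hy (Fin.last d)
      simp [graphMap_apply, proj_snoc, coneV] at h1 h2
      subst h1
      exact hs (by linarith)
  · intro i
    simp only [hpr]
    rcases Fin.eq_zero_or_eq_succ i with rfl | ⟨k, rfl⟩
    · have h3 := b.ind.comp_embedding
        (⟨fun j : {y : Fin (d + 2) // y ≠ 0} => j.1.pred j.2, by
          intro i j h
          exact Subtype.ext (Fin.pred_inj.1 h)⟩ : {y : Fin (d + 2) // y ≠ 0} ↪ Fin (d + 1))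
      refine affineIndependent_congr h3 fun j => ?_
      obtain ⟨j, hj⟩ := j
      obtain ⟨k, rfl⟩ := Fin.exists_succ_eq.2 hj
      rfl
    · have h3 := (affineIndependent_update b q k (hq k)).comp_embedding
        (⟨fun j : {y : Fin (d + 2) // y ≠ k.succ} =>
            Fin.cases (motive := fun _ => Fin (d + 1)) k id j.1, by
          rintro ⟨i, hi⟩ ⟨j, hj⟩ h
          apply Subtype.ext
          revert hi hj h
          refine Fin.cases ?_ (fun i => ?_) i <;> refine Fin.cases ?_ (fun j => ?_) j
          · simp
          · intro hi hj h
            simp at h hj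
            exact absurd h.symm hj
          · intro hi hj h
            simp at h hi
            exact absurd h hi
          · intro hi hj h
            simpa using h⟩ : {y : Fin (d + 2) // y ≠ k.succ} ↪ Fin (d + 1))
      refine affineIndependent_congr h3 fun j => ?_
      obtain ⟨j, hj⟩ := j
      revert hj
      refine Fin.cases ?_ (fun j => ?_) j
      · intro hj
        exact (Function.update_self (β := fun _ => Fin d → ℝ) k q b).symm
      · intro hj
        have : j ≠ k := fun h => hj (by rw [h])
        exact (Function.update_of_ne (β := fun _ => Fin d → ℝ) this q b).symm

theorem exists_generic {d m : ℕ} (b : Fin m → AffineBasis (Fin (d + 1)) ℝ (Fin d → ℝ)) :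
    ∃ q : Fin d → ℝ, ∀ i k, (b i).coord k q ≠ 0 := by
  have hnull : volume (⋃ i, ⋃ k, {q : Fin d → ℝ | (b i).coord k q = 0}) = 0 := by
    rw [measure_iUnion_null_iff]
    intro i
    rw [measure_iUnion_null_iff]
    intro k
    have hne : (affineSpan ℝ {(0:ℝ)}).comap ((b i).coord k) ≠ ⊤ := by
      intro h
      have h2 : (b i k) ∈ (affineSpan ℝ {(0:ℝ)}).comap ((b i).coord k) := by
        rw [h]
        trivial
      simp at h2
    have := Measure.addHaar_affineSubspace volume _ hne
    convert this using 2
    ext y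
    simp
  by_contra! hcon
  have huniv : (⋃ i, ⋃ k, {q : Fin d → ℝ | (b i).coord k q = 0}) = Set.univ := by
    ext q
    simpa using hcon q
  rw [huniv] at hnull
  exact (NeZero.ne (volume : Measure (Fin d → ℝ))) (Measure.measure_univ_eq_zero.1 hnull)

theorem volume_parSet {d : ℕ} (S : Set (Fin d → ℝ)) (q x : Fin d → ℝ) :
    volume (parSet d S q x) =
      volume ({l : ℝ | q + l⁻¹ • (x - q) ∈ S} ∩ Set.Ioc 0 1) := by
  apply le_antisymm
  · have hsub : parSet d S q x ⊆ ({l : ℝ | q + l⁻¹ • (x - q) ∈ S} ∩ Set.Ioc 0 1) ∪ {0} := by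
      rintro l ⟨h0, h1, y, hy, hx⟩
      rcases h0.eq_or_lt with rfl | h0
      · right
        rfl
      · left
        refine ⟨?_, h0, h1⟩
        have : q + l⁻¹ • (x - q) = y := by
          rw [hx]
          ext i
          simp
          field_simp
          ring
        simpa [this] using hy
    refine (measure_mono hsub).trans ((measure_union_le _ _).trans ?_)
    simp
  · apply measure_mono
    rintro l ⟨hl, h0, h1⟩
    refine ⟨h0.le, h1, _, hl, ?_⟩
    have := h0.ne'
    ext i
    simp
    field_simp
    ring

theorem affine_ray {d : ℕ} (a : (Fin d → ℝ) →ᵃ[ℝ] ℝ) (q u : Fin d → ℝ) (l : ℝ) (hl : l ≠ 0) :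
    l * a (q + l⁻¹ • u) = l * a q + a.linear u := by
  have : a (q + l⁻¹ • u) = l⁻¹ * a.linear u + a q := by
    have := a.map_vadd q (l⁻¹ • u)
    simp only [vadd_eq_add, map_smul, smul_eq_mul] at this
    rw [add_comm q, this]
  rw [this]
  field_simp
  ring

theorem radial_formula {d m : ℕ} (f : (Fin d → ℝ) → ℝ) (hfc : Continuous f)
    (hfs : HasCompactSupport f) (b : Fin m → AffineBasis (Fin (d + 1)) ℝ (Fin d → ℝ))
    (hdisj : Pairwise fun i j => interior (convexHull ℝ (Set.range (b i))) ∩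
          interior (convexHull ℝ (Set.range (b j))) = ∅)
    (g : Fin m → (Fin d → ℝ) →ᵃ[ℝ] ℝ)
    (hg : ∀ i, ∀ x ∈ convexHull ℝ (Set.range (b i)), f x = g i x)
    (h0 : ∀ x : Fin d → ℝ, x ∉ ⋃ i, convexHull ℝ (Set.range (b i)) → f x = 0)
    (q : Fin d → ℝ) (hq : ∀ i k, (b i).coord k q ≠ 0) (x : Fin d → ℝ) :
    f x = ∑ i, g i q * (volume (parSet d (convexHull ℝ (Set.range (b i))) q x)).toReal := by
  classical
  set y : ℝ → Fin d → ℝ := fun l => q + l⁻¹ • (x - q) with hy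
  have hycont : ∀ l : ℝ, l ≠ 0 → ContinuousAt y l := by
    intro l hl
    exact continuousAt_const.add ((continuousAt_inv₀ hl).smul continuousAt_const)
  have hymeas : Measurable y := by
    exact measurable_const.add (measurable_inv.smul_const _)
  have hclosed : ∀ i, IsClosed (convexHull ℝ (Set.range (b i))) := fun i =>
    (Set.finite_range (b i)).isClosed_convexHull ℝ
  set B : Fin m → Set ℝ := fun i => {l : ℝ | y l ∈ convexHull ℝ (Set.range (b i))} with hB
  have hBm : ∀ i, MeasurableSet (B i) := fun i => hymeas (hclosed i).measurableSet
  set E : Set ℝ := ⋃ i, ⋃ k, {l : ℝ | l * (b i).coord k q + ((b i).coord k).linear (x - q) = 0}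
    with hE
  have hEc : E.Countable := by
    refine Set.countable_iUnion fun i => Set.countable_iUnion fun k => ?_
    apply Set.Subsingleton.countable
    intro l hl l' hl'
    simp only [Set.mem_ofPred_eq] at hl hl'
    exact mul_right_cancel₀ (hq i k) (by linarith)
  have hint : ∀ l : ℝ, 0 < l → l ∉ E → ∀ i, l ∈ B i →
      y l ∈ interior (convexHull ℝ (Set.range (b i))) := by
    intro l hl hlE i hli
    rw [AffineBasis.interior_convexHull]
    have hli' : y l ∈ convexHull ℝ (Set.range (b i)) := hli
    rw [AffineBasis.convexHull_eq_nonneg_coord] at hli'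
    intro k
    refine lt_of_le_of_ne (hli' k) ?_
    intro h
    apply hlE
    simp only [hE, Set.mem_iUnion]
    refine ⟨i, k, ?_⟩
    simp only [Set.mem_ofPred_eq]
    rw [← affine_ray _ _ _ _ hl.ne']
    change l * (b i).coord k (y l) = 0
    rw [← h, mul_zero]
  set ψ : ℝ → ℝ := fun l => l * f (y l) with hψ
  obtain ⟨C, hC⟩ := hfs.exists_bound_of_continuous hfc
  have hψc : ContinuousOn ψ (Set.Icc 0 1) := by
    intro l _
    apply ContinuousAt.continuousWithinAt
    by_cases hl : l = 0
    · subst hl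
      have : ψ 0 = 0 := by simp [hψ]
      rw [ContinuousAt, this]
      apply squeeze_zero_norm (a := fun l => |l| * C)
      · intro l
        rw [hψ]
        simp only [norm_mul, Real.norm_eq_abs]
        exact mul_le_mul_of_nonneg_left (hC _) (abs_nonneg _)
      · have : Continuous fun l : ℝ => |l| * C := by fun_prop
        simpa using this.tendsto 0
    · exact continuousAt_id.mul (hfc.continuousAt.comp (hycont l hl))
  have hder : ∀ l ∈ Set.Ioo (0:ℝ) 1 \ E,
      HasDerivAt ψ (∑ i, (B i).indicator (fun _ => g i q) l) l := by
    rintro l ⟨⟨hl0, hl1⟩, hlE⟩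
    by_cases hex : ∃ i, l ∈ B i
    · obtain ⟨i, hi⟩ := hex
      have hii := hint l hl0 hlE i hi
      have hsum : (∑ j, (B j).indicator (fun _ => g j q) l) = g i q := by
        rw [Finset.sum_eq_single i]
        · simp [hi]
        · intro j _ hji
          rw [Set.indicator_of_notMem]
          intro hj
          have hjj := hint l hl0 hlE j hj
          have : y l ∈ (∅ : Set (Fin d → ℝ)) := by
            rw [← hdisj hji]
            exact ⟨hjj, hii⟩
          exact this
        · simp
      rw [hsum]
      have hloc : ψ =ᶠ[nhds l] fun l => l * g i q + (g i).linear (x - q) := by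
        have h1 : ∀ᶠ l' in nhds l, y l' ∈ interior (convexHull ℝ (Set.range (b i))) :=
          (hycont l hl0.ne').eventually (isOpen_interior.mem_nhds hii)
        filter_upwards [h1, eventually_ne_nhds hl0.ne'] with l' h1 h2
        rw [← affine_ray _ _ _ _ h2]
        simp only [hψ]
        rw [hg i _ (interior_subset h1)]
      refine HasDerivAt.congr_of_eventuallyEq ?_ hloc
      simpa using ((hasDerivAt_id l).mul_const (g i q)).add_const ((g i).linear (x - q))
    · push Not at hex
      have hsum : (∑ j, (B j).indicator (fun _ => g j q) l) = 0 :=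
        Finset.sum_eq_zero fun j _ => Set.indicator_of_notMem (hex j) _
      rw [hsum]
      have hloc : ψ =ᶠ[nhds l] fun _ => 0 := by
        have hcl : IsClosed (⋃ i, convexHull ℝ (Set.range (b i))) :=
          isClosed_iUnion_of_finite hclosed
        have hmem : y l ∈ (⋃ i, convexHull ℝ (Set.range (b i)))ᶜ := by
          simp only [Set.mem_compl_iff, Set.mem_iUnion, not_exists]
          exact hex
        have h1 := (hycont l hl0.ne').eventually (hcl.isOpen_compl.mem_nhds hmem)
        filter_upwards [h1] with l' h1
        simp only [hψ]
        rw [h0 _ h1, mul_zero]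
      exact (hasDerivAt_const l (0:ℝ)).congr_of_eventuallyEq hloc
  have hii : ∀ i, IntervalIntegrable (fun l => (B i).indicator (fun _ => g i q) l) volume 0 1 := by
    intro i
    rw [intervalIntegrable_iff_integrableOn_Ioc_of_le zero_le_one]
    exact (integrable_const (g i q)).indicator (hBm i)
  have hFTC := integral_eq_of_hasDerivAt_off_countable_of_le ψ
    (fun l => ∑ i, (B i).indicator (fun _ => g i q) l) zero_le_one hEc hψc hder
    (by
      have := IntervalIntegrable.sum Finset.univ (fun i _ => hii i)
      have e : (fun l => ∑ i, (B i).indicator (fun _ => g i q) l) =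
          ∑ i, fun l => (B i).indicator (fun _ => g i q) l := by
        funext l
        simp
      rw [e]
      exact this)
  have hψ1 : ψ 1 - ψ 0 = f x := by simp [hψ, hy]
  rw [hψ1, intervalIntegral.integral_finsetSum (fun i _ => hii i)] at hFTC
  rw [← hFTC]
  refine Finset.sum_congr rfl fun i _ => ?_
  rw [intervalIntegral.integral_of_le zero_le_one, integral_indicator (hBm i),
    volume_parSet, setIntegral_const, smul_eq_mul, mul_comm, measureReal_def,
    Measure.restrict_apply (hBm i)]

theorem sign_mul_abs_choice (c : ℝ) : ∃ e : ℝ, (e = 1 ∨ e = -1) ∧ e * |c| = c := by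
  rcases le_total 0 c with h | h
  · exact ⟨1, Or.inl rfl, by rw [abs_of_nonneg h, one_mul]⟩
  · exact ⟨-1, Or.inr rfl, by rw [abs_of_nonpos h]; ring⟩

/-- Decomposition theorem: any `f ∈ PL(d,n)` is a signed sum of at most `2n` simplex
functions. -/
theorem pl_eq_signed_sum_simplexFn (d n : ℕ) (f : (Fin d → ℝ) → ℝ) (hf : IsPL d n f) :
    ∃ (m : ℕ) (_ : m ≤ 2 * n) (v : Fin m → Fin (d + 2) → (Fin (d + 1) → ℝ))
      (ε : Fin m → ℝ),
      (∀ i, IsNondegSimplex d (v i)) ∧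
      (∀ i, ε i = 1 ∨ ε i = -1) ∧
      (∀ x : Fin d → ℝ, f x = ∑ i, ε i * simplexFn d (v i) x) := by
  obtain ⟨hfc, hfs, m, hmn, w, hw, hdisj, hg, h0⟩ := hf
  choose g hg using hg
  let b : Fin m → AffineBasis (Fin (d + 1)) ℝ (Fin d → ℝ) := fun i =>
    ⟨w i, hw i, by
      rw [(hw i).affineSpan_eq_top_iff_card_eq_finrank_add_one]
      simp⟩
  obtain ⟨q, hq⟩ := exists_generic b
  have hrad := radial_formula f hfc hfs b hdisj g hg h0 q hq
  obtain ⟨s, hs⟩ := Infinite.exists_notMem_finset (insert (0:ℝ) (Finset.univ.image fun i => g i q))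
  have hs0 : s - (0 : (Fin d → ℝ) →ᵃ[ℝ] ℝ) q ≠ 0 := by
    intro h
    apply hs
    simp at h
    simp [h]
  have hsg : ∀ i, s - g i q ≠ 0 := by
    intro i h
    apply hs
    rw [Finset.mem_insert, Finset.mem_image]
    exact Or.inr ⟨i, Finset.mem_univ _, by linarith⟩
  choose e he he' using fun i => sign_mul_abs_choice (s - g i q)
  obtain ⟨e0, he0, he0'⟩ := sign_mul_abs_choice s
  refine ⟨m + m, by omega,
    Fin.append (fun i => coneV d (b i) (g i) q s) (fun i => coneV d (b i) 0 q s),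
    Fin.append (fun i => -e i) (fun _ => e0), ?_, ?_, ?_⟩
  · intro i
    refine Fin.addCases (fun i => ?_) (fun i => ?_) i
    · rw [Fin.append_left]
      exact coneV_nondeg (b i) _ q s (hsg i) (hq i)
    · rw [Fin.append_right]
      exact coneV_nondeg (b i) _ q s hs0 (hq i)
  · intro i
    refine Fin.addCases (fun i => ?_) (fun i => ?_) i
    · rw [Fin.append_left]
      rcases he i with h | h <;> simp [h]
    · rw [Fin.append_right]
      exact he0
  · intro x
    rw [Fin.sum_univ_add, hrad x, ← Finset.sum_add_distrib]
    refine Finset.sum_congr rfl fun i _ => ?_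
    simp only [Fin.append_left, Fin.append_right]
    rw [simplexFn_coneV _ _ _ _ _ (hsg i), simplexFn_coneV _ _ _ _ _ hs0]
    have h1 := he' i
    simp only [AffineMap.coe_zero, Pi.zero_apply, sub_zero]
    generalize (volume (parSet d (convexHull ℝ (Set.range (b i))) q x)).toReal = L
    linear_combination L * h1 - L * he0'
end
end
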